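/- Let ε^μ = diag(ε,ε,1,1,1) and let b₂ ∈ GL₅(L) be the 5×5 matrix with rows (0,1,0,0,0), (0,0,1,0,0), (ε,0,0,0,0), (0,0,0,0,1), (0,0,0,ε,0) (a representative of the σ-conjugacy class with Newton slopes (1/3,1/3,1/3,1/2,1/2)). Then for every b ∈ K·ε^μ·K that is σ-conjugate in GL₅(L) to b₂, there exist t ∈ k and g ∈ K with g^{-1}·b·σ(g) = x_t, where x_t is the 5×5 matrix with rows (0,1,0,0,0), (0,0,1,0,0), (ε,0,0,0,0), (t,0,0,0,1), (0,0,0,ε,0). -/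

import Mathlib

open scoped MatrixGroups

/-- A Laurent series lies in the ring of integers `O = k[[ε]]`. -/
def InO {k : Type*} [Field k] (x : LaurentSeries k) : Prop :=
  ∀ m : ℤ, m < 0 → x.coeff m = 0

/-- Membership in `K = GL₅(O)`: both `g` and `g⁻¹` have entries in `O`. -/
def InK {k : Type*} [Field k] {n : ℕ} (g : GL (Fin n) (LaurentSeries k)) : Prop :=
  (∀ i j, InO ((g : Matrix (Fin n) (Fin n) (LaurentSeries k)) i j)) ∧
  (∀ i j, InO (((g⁻¹ : GL (Fin n) (LaurentSeries k)) :
      Matrix (Fin n) (Fin n) (LaurentSeries k)) i j))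

section Helpers

variable {k : Type*} [Field k]

/-- The monomial `ε ^ a`. -/
noncomputable def sg (k : Type*) [Field k] (a : ℤ) : LaurentSeries k := HahnSeries.single a 1

/-- All coefficients below `n` vanish. -/
def GeV (n : ℤ) (x : LaurentSeries k) : Prop := ∀ m : ℤ, m < n → x.coeff m = 0

theorem coeff_sg_mul (a : ℤ) (x : LaurentSeries k) (i : ℤ) :
    (sg k a * x).coeff i = x.coeff (i - a) := by
  simp [sg, HahnSeries.coeff_single_mul]

theorem coeff_sg (a i : ℤ) : (sg k a).coeff i = if i = a then 1 else 0 := by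
  simp [sg, HahnSeries.coeff_single]

theorem coeff_C_mul' (a : k) (x : LaurentSeries k) (i : ℤ) :
    (HahnSeries.C a * x).coeff i = a * x.coeff i := by
  rw [HahnSeries.C_apply, HahnSeries.coeff_single_zero_mul]

theorem sg_mul_sg (a b : ℤ) : sg k a * sg k b = sg k (a + b) := by
  simp [sg]

theorem sg_zero : sg k 0 = 1 := rfl

theorem sg_ne_zero (a : ℤ) : sg k a ≠ 0 := by simp [sg]

theorem GeV.add {n : ℤ} {x y : LaurentSeries k} (hx : GeV n x) (hy : GeV n y) :
    GeV n (x + y) := fun m hm => by simp [hx m hm, hy m hm]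

theorem GeV.sub {n : ℤ} {x y : LaurentSeries k} (hx : GeV n x) (hy : GeV n y) :
    GeV n (x - y) := fun m hm => by simp [hx m hm, hy m hm]

theorem GeV.neg {n : ℤ} {x : LaurentSeries k} (hx : GeV n x) :
    GeV n (-x) := fun m hm => by simp [hx m hm]

theorem GeV.zero (n : ℤ) : GeV n (0 : LaurentSeries k) := fun m hm => by simp

theorem GeV.mono {n m : ℤ} {x : LaurentSeries k} (hx : GeV n x) (h : m ≤ n) :
    GeV m x := fun i hi => hx i (by omega)

theorem GeV.sum {ι : Type*} (s : Finset ι) {n : ℤ} {f : ι → LaurentSeries k}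
    (hf : ∀ i ∈ s, GeV n (f i)) : GeV n (∑ i ∈ s, f i) := by
  classical
  induction s using Finset.induction_on with
  | empty => simpa using GeV.zero n
  | insert a s ha ih =>
    rw [Finset.sum_insert ha]
    exact (hf _ (by simp)).add (ih fun i hi => hf i (by simp [hi]))

theorem GeV.mul {n m : ℤ} {x y : LaurentSeries k} (hx : GeV n x) (hy : GeV m y) :
    GeV (n + m) (x * y) := by
  intro i hi
  rw [HahnSeries.coeff_mul]
  apply Finset.sum_eq_zero
  rintro ⟨a, b⟩ hab
  have h2 : a + b = i := by
    simp at hab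
    exact hab.2.2
  by_cases ha : a < n
  · simp [hx a ha]
  · simp [hy b (by omega)]

theorem GeV.sg_mul {n : ℤ} {x : LaurentSeries k} (hx : GeV n x) (a : ℤ) :
    GeV (a + n) (sg k a * x) := by
  intro i hi
  rw [coeff_sg_mul]
  exact hx _ (by omega)

theorem GeV.sg (a : ℤ) : GeV a (sg k a) := by
  intro i hi
  rw [coeff_sg, if_neg (by omega)]

theorem exists_GeV (x : LaurentSeries k) : ∃ n, GeV n x :=
  ⟨x.order, fun _ hm => HahnSeries.coeff_eq_zero_of_lt_order hm⟩

theorem exists_GeV_matrix {n : ℕ} (A : Matrix (Fin n) (Fin n) (LaurentSeries k)) :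
    ∃ N : ℤ, ∀ i j, GeV N (A i j) := by
  choose f hf using fun i j => exists_GeV (A i j)
  obtain ⟨N, hN⟩ := (Set.finite_range (fun ij : Fin n × Fin n => f ij.1 ij.2)).bddBelow
  exact ⟨N, fun i j => (hf i j).mono (hN ⟨(i, j), rfl⟩)⟩

theorem GeV.mulVec {n : ℕ} {A : Matrix (Fin n) (Fin n) (LaurentSeries k)} {v : Fin n → LaurentSeries k}
    {N M : ℤ} (hA : ∀ i j, GeV N (A i j)) (hv : ∀ i, GeV M (v i)) (i : Fin n) :
    GeV (N + M) ((A.mulVec v) i) := by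
  rw [Matrix.mulVec, dotProduct]
  exact GeV.sum _ fun j _ => (hA i j).mul (hv j)

/-- Laurent series with given coefficients. -/
theorem exists_series (f : ℤ → k) (n : ℤ) (hf : ∀ m < n, f m = 0) :
    ∃ x : LaurentSeries k, ∀ i, x.coeff i = f i :=
  ⟨HahnSeries.ofSuppBddBelow f ⟨n, fun m hm => not_lt.1 fun h => hm (hf m h)⟩, fun _ => rfl⟩

theorem sigma_GeV (σ : LaurentSeries k →+* LaurentSeries k) (q : ℕ) (hq : 0 < q)
    (hσ : ∀ (x : LaurentSeries k) (m : ℤ), (σ x).coeff m = x.coeff m ^ q)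
    {n : ℤ} {x : LaurentSeries k} : GeV n (σ x) ↔ GeV n x := by
  simp [GeV, hσ, hq.ne']

theorem sigma_sg (σ : LaurentSeries k →+* LaurentSeries k) (q : ℕ) (hq : 0 < q)
    (hσ : ∀ (x : LaurentSeries k) (m : ℤ), (σ x).coeff m = x.coeff m ^ q)
    (a : ℤ) : σ (sg k a) = sg k a := by
  ext i
  rw [hσ, coeff_sg]
  split_ifs <;> simp [hq.ne']

theorem sigma_C (σ : LaurentSeries k →+* LaurentSeries k) (q : ℕ) (hq : 0 < q)
    (hσ : ∀ (x : LaurentSeries k) (m : ℤ), (σ x).coeff m = x.coeff m ^ q)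
    (a : k) : σ (HahnSeries.C a) = HahnSeries.C (a ^ q) := by
  ext i
  rw [hσ, HahnSeries.C_apply, HahnSeries.C_apply, HahnSeries.coeff_single, HahnSeries.coeff_single]
  split_ifs <;> simp [hq.ne']

theorem sigma_surj (σ : LaurentSeries k →+* LaurentSeries k) (q : ℕ) (hq : 0 < q)
    (hσ : ∀ (x : LaurentSeries k) (m : ℤ), (σ x).coeff m = x.coeff m ^ q)
    [IsAlgClosed k] (y : LaurentSeries k) : ∃ x, σ x = y := by
  choose f hf using fun a : k => IsAlgClosed.exists_pow_nat_eq a hq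
  obtain ⟨n, hn⟩ := exists_GeV y
  obtain ⟨x, hx⟩ := exists_series (fun i => f (y.coeff i)) n (by
    intro m hm
    have := hf (y.coeff m)
    rw [hn m hm] at this ⊢
    exact pow_eq_zero_iff hq.ne' |>.1 this)
  refine ⟨x, ?_⟩
  ext i
  rw [hσ, hx, hf]

/-- An `F`-stable lattice in the isoclinic space is a standard one. -/
theorem onedim (σ : LaurentSeries k →+* LaurentSeries k) (q : ℕ) (hq : 0 < q)
    (hσ : ∀ (x : LaurentSeries k) (m : ℤ), (σ x).coeff m = x.coeff m ^ q)
    (A : AddSubgroup (LaurentSeries k))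
    (hC : ∀ (a : k) x, x ∈ A → HahnSeries.C a * x ∈ A)
    (hF : ∀ x ∈ A, sg k 1 * σ x ∈ A)
    (hlo : ∃ N, ∀ x ∈ A, GeV N x)
    (hhi : ∃ N, ∀ x, GeV N x → x ∈ A) : ∃ m, ∀ x, x ∈ A ↔ GeV m x := by
  obtain ⟨N, hN⟩ := hhi
  obtain ⟨m, hm, hmax⟩ := Int.exists_greatest_of_bdd (P := fun m => ∀ x ∈ A, GeV m x)
    ⟨N, fun z hz => by
      by_contra hlt
      have := hz _ (hN _ (GeV.sg N)) N (by omega)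
      simp [coeff_sg] at this⟩ hlo
  have h1 : ∃ y ∈ A, y.coeff m ≠ 0 := by
    by_contra hcon
    push Not at hcon
    have := hmax (m + 1) (fun x hx i hi => by
      rcases (show i < m ∨ i = m by omega) with h | rfl
      · exact hm x hx i h
      · exact hcon x hx)
    omega
  obtain ⟨y, hyA, hy⟩ := h1
  have h2 : ∀ l : ℕ, ∃ y ∈ A, GeV (m + l) y ∧ y.coeff (m + l) ≠ 0 := by
    intro l
    induction l with
    | zero => exact ⟨y, hyA, by simpa using hm y hyA, by simpa using hy⟩
    | succ l ih =>
      obtain ⟨z, hz, hz1, hz2⟩ := ih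
      refine ⟨_, hF z hz, ?_, ?_⟩
      · have := ((sigma_GeV σ q hq hσ).2 hz1).sg_mul 1
        exact this.mono (by push_cast; omega)
      · rw [coeff_sg_mul, hσ]
        have : m + ((l + 1 : ℕ) : ℤ) - 1 = m + l := by push_cast; omega
        rw [this]
        exact pow_ne_zero _ hz2
  have h3 : ∀ d : ℕ, ∀ x, m ≤ N - d → GeV (N - d) x → x ∈ A := by
    intro d
    induction d with
    | zero => intro x _ hx; exact hN x (by simpa using hx)
    | succ d ih =>
      intro x hmd hx
      push_cast at hmd hx
      obtain ⟨l, hl⟩ := Int.eq_ofNat_of_zero_le (show 0 ≤ N - (d + 1) - m by omega)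
      obtain ⟨z, hz, hz1, hz2⟩ := h2 l
      have e : m + (l : ℤ) = N - (d + 1) := by omega
      rw [e] at hz1 hz2
      have h4 : x - HahnSeries.C (x.coeff (N - (d + 1)) / z.coeff (N - (d + 1))) * z ∈ A := by
        apply ih _ (by omega)
        intro i hi
        rw [HahnSeries.coeff_sub, coeff_C_mul']
        rcases (show i < N - (d + 1) ∨ i = N - (d + 1) by omega) with h | rfl
        · simp [hx i h, hz1 i h]
        · field_simp
          simp
      have := A.add_mem h4 (hC (x.coeff (N - (d + 1)) / z.coeff (N - (d + 1))) z hz)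
      simpa using this
  refine ⟨m, fun x => ⟨fun hx => hm x hx, fun hx => ?_⟩⟩
  by_cases hmN : m ≤ N
  · obtain ⟨d, hd⟩ := Int.eq_ofNat_of_zero_le (show 0 ≤ N - m by omega)
    exact h3 d x (by omega) (by rwa [← hd, sub_sub_cancel])
  · exact hN x (hx.mono (by omega))

/-- The recursion killing the higher terms. -/
def recA (q : ℕ) (f : ℤ → k) (n : ℤ) : ℕ → k
  | 0 => f (n + 2)
  | l + 1 => ((recA q f n l ^ q) ^ q) ^ q + f (n + l + 3)

theorem solve (σ : LaurentSeries k →+* LaurentSeries k) (q : ℕ) (hq : 0 < q)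
    (hσ : ∀ (x : LaurentSeries k) (m : ℤ), (σ x).coeff m = x.coeff m ^ q)
    (x : LaurentSeries k) (n : ℤ) (hx : GeV (n + 1) x) :
    ∃ y : LaurentSeries k, GeV n y ∧
      sg k 1 * σ (sg k 1 * σ (sg k 1 * σ y)) + x =
        sg k 2 * y + HahnSeries.C (x.coeff (n + 1)) * (sg k 1 * sg k n) := by
  obtain ⟨y, hy⟩ := exists_series
    (fun i => if i < n then 0 else recA q x.coeff n (i - n).toNat) n
    (fun m hm => by simp [hm])
  refine ⟨y, fun m hm => by simp [hy, hm], ?_⟩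
  ext i
  simp only [HahnSeries.coeff_add, coeff_C_mul', coeff_sg_mul, hσ, coeff_sg, hy]
  rcases lt_trichotomy i (n + 1) with h | rfl | h
  · rw [hx i h, if_pos (by omega), if_pos (by omega), if_neg (by omega)]
    simp [hq.ne']
  · rw [if_pos (by omega), if_pos (by omega), if_pos (by omega)]
    simp [hq.ne']
  · rw [if_neg (show ¬ (i - 1 = n) by omega), if_neg (show ¬ (i - 2 < n) by omega)]
    rcases (show i = n + 2 ∨ n + 3 ≤ i by omega) with rfl | h3
    · rw [if_pos (by omega)]
      simp [hq.ne', recA]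
    · obtain ⟨l, hl⟩ := Int.eq_ofNat_of_zero_le (show 0 ≤ i - (n + 3) by omega)
      obtain rfl : i = n + l + 3 := by omega
      rw [if_neg (by omega)]
      have e1 : (n + (l : ℤ) + 3 - 1 - 1 - 1 - n).toNat = l := by omega
      have e2 : (n + (l : ℤ) + 3 - 2 - n).toNat = l + 1 := by omega
      rw [e1, e2, recA]
      simp

theorem core (σ : LaurentSeries k →+* LaurentSeries k) (q : ℕ) (hq : 0 < q)
    (hσ : ∀ (x : LaurentSeries k) (m : ℤ), (σ x).coeff m = x.coeff m ^ q)
    (M : AddSubgroup (LaurentSeries k × LaurentSeries k))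
    (hC : ∀ (a : k) z, z ∈ M → (HahnSeries.C a * z.1, HahnSeries.C a * z.2) ∈ M)
    (hF : ∀ z ∈ M, (sg k 1 * σ z.1, sg k 1 * σ z.2) ∈ M)
    (hV : ∀ z ∈ M, ∃ w ∈ M, sg k 1 * σ w.1 = sg k 3 * z.1 ∧ sg k 1 * σ w.2 = sg k 2 * z.2)
    (hlo : ∃ N, ∀ z ∈ M, GeV N z.1 ∧ GeV N z.2)
    (hhi : ∃ N, ∀ x y, GeV N x → GeV N y → (x, y) ∈ M) :
    ∃ m n : ℤ, ∃ t : k, ∃ Y : LaurentSeries k, (sg k m, Y) ∈ M ∧ (∀ z ∈ M, GeV m z.1) ∧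
      (∀ y, (0, y) ∈ M ↔ GeV n y) ∧
      sg k 1 * σ (sg k 1 * σ (sg k 1 * σ Y)) =
        sg k 2 * Y + HahnSeries.C t * (sg k 1 * sg k n) := by
  obtain ⟨Nl, hNl⟩ := hlo
  obtain ⟨Nh, hNh⟩ := hhi
  obtain ⟨m, hm⟩ := onedim σ q hq hσ (M.map (AddMonoidHom.fst _ _))
    (by rintro a _ ⟨z, hz, rfl⟩; exact ⟨_, hC a z hz, rfl⟩)
    (by rintro _ ⟨z, hz, rfl⟩; exact ⟨_, hF z hz, rfl⟩)
    ⟨Nl, by rintro _ ⟨z, hz, rfl⟩; exact (hNl z hz).1⟩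
    ⟨Nh, fun x hx => ⟨(x, 0), hNh x 0 hx (GeV.zero _), rfl⟩⟩
  obtain ⟨n, hn⟩ := onedim σ q hq hσ (M.comap (AddMonoidHom.inr (LaurentSeries k) (LaurentSeries k)))
    (by intro a x hx; simpa using hC a _ hx)
    (by intro x hx; simpa using hF _ hx)
    ⟨Nl, fun x hx => (hNl _ hx).2⟩
    ⟨Nh, fun x hx => hNh 0 x (GeV.zero _) hx⟩
  have hn' : ∀ y, (0, y) ∈ M ↔ GeV n y := fun y => hn y
  obtain ⟨⟨X, Y1⟩, hz, hX⟩ := (hm (sg k m)).2 (GeV.sg m)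
  replace hX : X = sg k m := hX
  subst hX
  obtain ⟨⟨w1, w2⟩, hw, hw1, hw2⟩ := hV _ hz
  have hF2 := hF _ (hF _ hz)
  have hu := M.sub_mem hF2 hw
  simp only [Prod.mk_sub_mk] at hu
  have e1 : sg k 1 * σ (sg k 1 * σ (sg k m)) - w1 = 0 := by
    apply σ.injective
    apply mul_left_cancel₀ (sg_ne_zero (k := k) 1)
    rw [map_zero, mul_zero, map_sub, mul_sub, hw1]
    simp only [sigma_sg σ q hq hσ, sg_mul_sg]
    rw [sub_eq_zero]
    congr 1
    ring
  rw [e1, hn'] at hu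
  have hx := ((sigma_GeV σ q hq hσ).2 hu).sg_mul 1
  rw [map_sub, mul_sub, hw2] at hx
  set x := sg k 1 * σ (sg k 1 * σ (sg k 1 * σ Y1)) - sg k 2 * Y1 with hxdef
  obtain ⟨y, hy1, hy2⟩ := solve σ q hq hσ x n (by rwa [add_comm])
  refine ⟨m, n, x.coeff (n + 1), Y1 + y, ?_, fun z hz => (hm _).1 ⟨z, hz, rfl⟩, hn', ?_⟩
  · have := M.add_mem hz ((hn' y).2 hy1)
    simpa using this
  · have : sg k 1 * σ (sg k 1 * σ (sg k 1 * σ (Y1 + y))) =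
        sg k 1 * σ (sg k 1 * σ (sg k 1 * σ Y1)) + sg k 1 * σ (sg k 1 * σ (sg k 1 * σ y)) := by
      simp only [map_add, mul_add]
    rw [this, eq_sub_of_add_eq hy2, hxdef]
    ring

end Helpers

section Model

variable {k : Type*} [Field k]

theorem tau_aux1 (d : ℤ) (hd : 0 < d) : Function.Injective (AddMonoidHom.mulLeft d) := by
  intro a b h
  have h' : d * a = d * b := h
  exact mul_left_cancel₀ hd.ne' h'

theorem tau_aux2 (d : ℤ) (hd : 0 < d) (a b : ℤ) :
    AddMonoidHom.mulLeft d a ≤ AddMonoidHom.mulLeft d b ↔ a ≤ b := by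
  change d * a ≤ d * b ↔ a ≤ b
  exact mul_le_mul_iff_right₀ hd

/-- The substitution `ε ↦ ε ^ d`. -/
noncomputable def tau (k : Type*) [Field k] (d : ℤ) (hd : 0 < d) :
    LaurentSeries k →+* LaurentSeries k :=
  HahnSeries.embDomainRingHom (AddMonoidHom.mulLeft d) (tau_aux1 d hd) (tau_aux2 d hd)

theorem coeff_tau (d : ℤ) (hd : 0 < d) (x : LaurentSeries k) (j : ℤ) :
    (tau k d hd x).coeff (d * j) = x.coeff j := by
  rw [tau, HahnSeries.embDomainRingHom_apply]
  exact HahnSeries.embDomain_coeff (a := j)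

theorem coeff_tau_of_not_dvd (d : ℤ) (hd : 0 < d) (x : LaurentSeries k) (i : ℤ)
    (hi : ¬ d ∣ i) : (tau k d hd x).coeff i = 0 := by
  rw [tau, HahnSeries.embDomainRingHom_apply]
  apply HahnSeries.embDomain_of_notMem_range
  rintro ⟨j, hj⟩
  exact hi ⟨j, hj.symm⟩

theorem tau_sg (d : ℤ) (hd : 0 < d) (a : ℤ) : tau k d hd (sg k a) = sg k (d * a) := by
  rw [tau, HahnSeries.embDomainRingHom_apply, sg, HahnSeries.embDomain_single]
  rfl

theorem tau_C (d : ℤ) (hd : 0 < d) (a : k) :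
    tau k d hd (HahnSeries.C a) = HahnSeries.C a := by
  rw [tau, HahnSeries.embDomainRingHom_C]

theorem tau_sigma (σ : LaurentSeries k →+* LaurentSeries k) (q : ℕ) (hq : 0 < q)
    (hσ : ∀ (x : LaurentSeries k) (m : ℤ), (σ x).coeff m = x.coeff m ^ q)
    (d : ℤ) (hd : 0 < d) (x : LaurentSeries k) :
    tau k d hd (σ x) = σ (tau k d hd x) := by
  ext i
  rw [hσ]
  by_cases h : d ∣ i
  · obtain ⟨j, rfl⟩ := h
    rw [coeff_tau, coeff_tau, hσ]
  · rw [coeff_tau_of_not_dvd _ _ _ _ h, coeff_tau_of_not_dvd _ _ _ _ h, zero_pow (ne_of_gt hq)]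

/-- Three-step model. -/
noncomputable def cb3 (a b c : LaurentSeries k) : LaurentSeries k :=
  tau k 3 (by norm_num) a + sg k 1 * tau k 3 (by norm_num) b + sg k 2 * tau k 3 (by norm_num) c

/-- Two-step model. -/
noncomputable def cb2 (a b : LaurentSeries k) : LaurentSeries k :=
  tau k 2 (by norm_num) a + sg k 1 * tau k 2 (by norm_num) b

theorem cb3_coeff0 (a b c : LaurentSeries k) (j : ℤ) : (cb3 a b c).coeff (3 * j) = a.coeff j := by
  simp only [cb3, HahnSeries.coeff_add, coeff_sg_mul]
  rw [coeff_tau, coeff_tau_of_not_dvd _ _ _ (3 * j - 1) (by omega),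
    coeff_tau_of_not_dvd _ _ _ (3 * j - 2) (by omega)]
  simp

theorem cb3_coeff1 (a b c : LaurentSeries k) (j : ℤ) :
    (cb3 a b c).coeff (3 * j + 1) = b.coeff j := by
  simp only [cb3, HahnSeries.coeff_add, coeff_sg_mul]
  rw [coeff_tau_of_not_dvd _ _ _ (3 * j + 1) (by omega),
    coeff_tau_of_not_dvd _ _ _ (3 * j + 1 - 2) (by omega), add_sub_cancel_right, coeff_tau]
  simp

theorem cb3_coeff2 (a b c : LaurentSeries k) (j : ℤ) :
    (cb3 a b c).coeff (3 * j + 2) = c.coeff j := by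
  simp only [cb3, HahnSeries.coeff_add, coeff_sg_mul]
  rw [coeff_tau_of_not_dvd _ _ _ (3 * j + 2) (by omega),
    coeff_tau_of_not_dvd _ _ _ (3 * j + 2 - 1) (by omega), add_sub_cancel_right, coeff_tau]
  simp

theorem cb2_coeff0 (a b : LaurentSeries k) (j : ℤ) : (cb2 a b).coeff (2 * j) = a.coeff j := by
  simp only [cb2, HahnSeries.coeff_add, coeff_sg_mul]
  rw [coeff_tau, coeff_tau_of_not_dvd _ _ _ (2 * j - 1) (by omega)]
  simp

theorem cb2_coeff1 (a b : LaurentSeries k) (j : ℤ) :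
    (cb2 a b).coeff (2 * j + 1) = b.coeff j := by
  simp only [cb2, HahnSeries.coeff_add, coeff_sg_mul]
  rw [coeff_tau_of_not_dvd _ _ _ (2 * j + 1) (by omega), add_sub_cancel_right, coeff_tau]
  simp

theorem exists_cb3 (x : LaurentSeries k) : ∃ a b c, cb3 a b c = x ∧
    (∀ N, GeV (3 * N) x → GeV N a ∧ GeV N b ∧ GeV N c) := by
  obtain ⟨n, hn⟩ := exists_GeV x
  have key : ∀ r : ℤ, ∃ a : LaurentSeries k, ∀ j, a.coeff j = x.coeff (3 * j + r) := fun r =>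
    exists_series (fun j => x.coeff (3 * j + r)) (- |n| - |r|) (fun m hm => hn _ (by
      have := neg_abs_le n; have := neg_abs_le r; have := le_abs_self r; have := abs_nonneg n; omega))
  obtain ⟨a, ha⟩ := key 0
  obtain ⟨b, hb⟩ := key 1
  obtain ⟨c, hc⟩ := key 2
  refine ⟨a, b, c, ?_, fun N hN => ⟨fun i hi => ?_, fun i hi => ?_, fun i hi => ?_⟩⟩
  · ext i
    obtain ⟨j, rfl | rfl | rfl⟩ : ∃ j, i = 3 * j ∨ i = 3 * j + 1 ∨ i = 3 * j + 2 :=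
      ⟨i / 3, by omega⟩
    · rw [cb3_coeff0, ha, add_zero]
    · rw [cb3_coeff1, hb]
    · rw [cb3_coeff2, hc]
  · rw [ha]; exact hN _ (by omega)
  · rw [hb]; exact hN _ (by omega)
  · rw [hc]; exact hN _ (by omega)

theorem exists_cb2 (x : LaurentSeries k) : ∃ a b, cb2 a b = x ∧
    (∀ N, GeV (2 * N) x → GeV N a ∧ GeV N b) := by
  obtain ⟨n, hn⟩ := exists_GeV x
  have key : ∀ r : ℤ, ∃ a : LaurentSeries k, ∀ j, a.coeff j = x.coeff (2 * j + r) := fun r =>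
    exists_series (fun j => x.coeff (2 * j + r)) (- |n| - |r|) (fun m hm => hn _ (by
      have := neg_abs_le n; have := neg_abs_le r; have := le_abs_self r; have := abs_nonneg n; omega))
  obtain ⟨a, ha⟩ := key 0
  obtain ⟨b, hb⟩ := key 1
  refine ⟨a, b, ?_, fun N hN => ⟨fun i hi => ?_, fun i hi => ?_⟩⟩
  · ext i
    obtain ⟨j, rfl | rfl⟩ : ∃ j, i = 2 * j ∨ i = 2 * j + 1 := ⟨i / 2, by omega⟩
    · rw [cb2_coeff0, ha, add_zero]
    · rw [cb2_coeff1, hb]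
  · rw [ha]; exact hN _ (by omega)
  · rw [hb]; exact hN _ (by omega)

theorem cb3_GeV {N : ℤ} {a b c : LaurentSeries k} (ha : GeV N a) (hb : GeV N b) (hc : GeV N c) :
    GeV (3 * N) (cb3 a b c) := by
  intro i hi
  obtain ⟨j, rfl | rfl | rfl⟩ : ∃ j, i = 3 * j ∨ i = 3 * j + 1 ∨ i = 3 * j + 2 :=
    ⟨i / 3, by omega⟩
  · rw [cb3_coeff0]; exact ha _ (by omega)
  · rw [cb3_coeff1]; exact hb _ (by omega)
  · rw [cb3_coeff2]; exact hc _ (by omega)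

theorem cb2_GeV {N : ℤ} {a b : LaurentSeries k} (ha : GeV N a) (hb : GeV N b) :
    GeV (2 * N) (cb2 a b) := by
  intro i hi
  obtain ⟨j, rfl | rfl⟩ : ∃ j, i = 2 * j ∨ i = 2 * j + 1 := ⟨i / 2, by omega⟩
  · rw [cb2_coeff0]; exact ha _ (by omega)
  · rw [cb2_coeff1]; exact hb _ (by omega)

/-- The coordinates of `L ^ 5` in the two cyclic models. -/
noncomputable def Psi : (Fin 5 → LaurentSeries k) →+ LaurentSeries k × LaurentSeries k where
  toFun v := (cb3 (v 2) (v 1) (v 0), cb2 (v 4) (v 3))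
  map_zero' := by simp [cb3, cb2]
  map_add' v w := by
    simp only [cb3, cb2, Pi.add_apply, map_add, Prod.mk_add_mk, Prod.mk.injEq]
    constructor <;> ring

theorem Psi_apply (v : Fin 5 → LaurentSeries k) :
    Psi v = (cb3 (v 2) (v 1) (v 0), cb2 (v 4) (v 3)) := rfl

theorem Psi_smul (a : LaurentSeries k) (v : Fin 5 → LaurentSeries k) :
    Psi (a • v) = (tau k 3 (by norm_num) a * (Psi v).1, tau k 2 (by norm_num) a * (Psi v).2) := by
  simp only [Psi_apply, cb3, cb2, Pi.smul_apply, smul_eq_mul, map_mul, Prod.mk.injEq]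
  constructor <;> ring

theorem Psi_inj : Function.Injective (Psi (k := k)) := by
  intro v w h
  rw [Psi_apply, Psi_apply, Prod.mk.injEq] at h
  obtain ⟨h1, h2⟩ := h
  funext i
  ext j
  fin_cases i
  · have := congrArg (fun x => x.coeff (3 * j + 2)) h1
    simp only [cb3_coeff2] at this
    exact this
  · have := congrArg (fun x => x.coeff (3 * j + 1)) h1
    simp only [cb3_coeff1] at this
    exact this
  · have := congrArg (fun x => x.coeff (3 * j)) h1
    simp only [cb3_coeff0] at this
    exact this
  · have := congrArg (fun x => x.coeff (2 * j + 1)) h2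
    simp only [cb2_coeff1] at this
    exact this
  · have := congrArg (fun x => x.coeff (2 * j)) h2
    simp only [cb2_coeff0] at this
    exact this

theorem Psi_surj (N : ℤ) (x y : LaurentSeries k) (hx : GeV (3 * N) x) (hy : GeV (2 * N) y) :
    ∃ v, Psi v = (x, y) ∧ ∀ i, GeV N (v i) := by
  obtain ⟨a, b, c, h1, h2⟩ := exists_cb3 x
  obtain ⟨d, e, h3, h4⟩ := exists_cb2 y
  obtain ⟨ha, hb, hc⟩ := h2 N hx
  obtain ⟨hd, he⟩ := h4 N hy
  refine ⟨![c, b, a, e, d], ?_, ?_⟩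
  · rw [Psi_apply, ← h1, ← h3]; rfl
  · intro i
    fin_cases i <;> assumption

/-- The Frobenius `b₂ σ` on `L ^ 5`. -/
noncomputable def Fv (σ : LaurentSeries k →+* LaurentSeries k) (v : Fin 5 → LaurentSeries k) :
    Fin 5 → LaurentSeries k :=
  ![σ (v 1), σ (v 2), sg k 1 * σ (v 0), σ (v 4), sg k 1 * σ (v 3)]

theorem Psi_Fv (σ : LaurentSeries k →+* LaurentSeries k) (q : ℕ) (hq : 0 < q)
    (hσ : ∀ (x : LaurentSeries k) (m : ℤ), (σ x).coeff m = x.coeff m ^ q)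
    (v : Fin 5 → LaurentSeries k) :
    Psi (Fv σ v) = (sg k 1 * σ (Psi v).1, sg k 1 * σ (Psi v).2) := by
  have h1 : sg k 1 * sg k 2 = sg k 3 := sg_mul_sg 1 2
  have h2 : sg k 1 * sg k 1 = sg k 2 := sg_mul_sg 1 1
  have e1 : Psi (Fv σ v) = (cb3 (sg k 1 * σ (v 0)) (σ (v 2)) (σ (v 1)),
    cb2 (sg k 1 * σ (v 3)) (σ (v 4))) := rfl
  rw [e1, Psi_apply]
  simp only [cb3, cb2, map_add, map_mul, tau_sigma σ q hq hσ, sigma_sg σ q hq hσ, tau_sg,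
    Prod.mk.injEq, mul_one]
  rw [← h1, ← h2]
  constructor <;> ring

theorem Fv_eq (σ : LaurentSeries k →+* LaurentSeries k) (v : Fin 5 → LaurentSeries k) :
    (!![0, 1, 0, 0, 0;
          0, 0, 1, 0, 0;
          HahnSeries.single (1 : ℤ) 1, 0, 0, 0, 0;
          0, 0, 0, 0, 1;
          0, 0, 0, HahnSeries.single (1 : ℤ) 1, 0] :
        Matrix (Fin 5) (Fin 5) (LaurentSeries k)).mulVec (fun i => σ (v i)) = Fv σ v := by
  funext i
  fin_cases i <;> simp [Matrix.mulVec, dotProduct, Fin.sum_univ_five, Fv, sg]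

end Model

section Assembly

variable {k : Type*} [Field k]

theorem GeV.matmul {n : ℕ} {A B : Matrix (Fin n) (Fin n) (LaurentSeries k)}
    (hA : ∀ i j, GeV 0 (A i j)) (hB : ∀ i j, GeV 0 (B i j)) (i j : Fin n) :
    GeV 0 ((A * B) i j) := by
  rw [Matrix.mul_apply]
  exact GeV.sum _ fun l _ => by simpa using (hA i l).mul (hB l j)

/-- The lattice `h⁻¹ O ^ 5`. -/
def latt (H : Matrix (Fin 5) (Fin 5) (LaurentSeries k)) : AddSubgroup (Fin 5 → LaurentSeries k) where
  carrier := {v | ∀ i, GeV 0 ((H.mulVec v) i)}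
  zero_mem' := by intro i; simpa using GeV.zero 0
  add_mem' := by
    intro v w hv hw i
    rw [Matrix.mulVec_add]
    exact (hv i).add (hw i)
  neg_mem' := by
    intro v hv i
    rw [Matrix.mulVec_neg]
    exact (hv i).neg

theorem mem_latt {H : Matrix (Fin 5) (Fin 5) (LaurentSeries k)} {v : Fin 5 → LaurentSeries k} :
    v ∈ latt H ↔ ∀ i, GeV 0 ((H.mulVec v) i) := Iff.rfl

theorem smul_mem_latt {H : Matrix (Fin 5) (Fin 5) (LaurentSeries k)} {v : Fin 5 → LaurentSeries k}
    {a : LaurentSeries k} (ha : GeV 0 a) (hv : v ∈ latt H) : a • v ∈ latt H := by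
  intro i
  rw [Matrix.mulVec_smul]
  simpa using ha.mul (hv i)

theorem GeV_C (a : k) : GeV 0 (HahnSeries.C a : LaurentSeries k) := by
  intro i hi
  rw [HahnSeries.C_apply, HahnSeries.coeff_single_of_ne hi.ne]

theorem exists_basis [IsAlgClosed k] (σ : LaurentSeries k →+* LaurentSeries k) (q : ℕ) (hq : 0 < q)
    (hσ : ∀ (x : LaurentSeries k) (m : ℤ), (σ x).coeff m = x.coeff m ^ q)
    (b b' H H' : Matrix (Fin 5) (Fin 5) (LaurentSeries k))
    (hb : ∀ i j, GeV 0 (b i j)) (hb' : ∀ i j, GeV 0 (b' i j))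
    (hbb : b' * b = sg k 1 • 1) (hH : H' * H = 1)
    (hrel : ∀ v, H.mulVec (Fv σ v) = b.mulVec (fun i => σ ((H.mulVec v) i))) :
    ∃ (t : k) (E3 E5 : Fin 5 → LaurentSeries k), E3 ∈ latt H ∧ E5 ∈ latt H ∧
      (∀ v ∈ latt H, Fv σ v ∈ latt H) ∧
      Fv σ (Fv σ (Fv σ E3)) = sg k 1 • E3 + (HahnSeries.C t : LaurentSeries k) • Fv σ E5 ∧
      Fv σ (Fv σ E5) = sg k 1 • E5 ∧
      ∀ v ∈ latt H, ∃ c : Fin 5 → LaurentSeries k, (∀ i, GeV 0 (c i)) ∧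
        v = c 0 • Fv σ (Fv σ E3) + c 1 • Fv σ E3 + c 2 • E3 + c 3 • Fv σ E5 + c 4 • E5 := by
  have hFm : ∀ v ∈ latt H, Fv σ v ∈ latt H := by
    intro v hv i
    rw [hrel]
    have := GeV.mulVec hb (fun i => (sigma_GeV σ q hq hσ).2 (hv i)) i
    simpa using this
  have hV : ∀ v ∈ latt H, ∃ w ∈ latt H, Fv σ w = sg k 1 • v := by
    intro v hv
    choose s hs using sigma_surj σ q hq hσ
    refine ⟨![s (v 2), s (sg k 1 * v 0), s (sg k 1 * v 1), s (v 4), s (sg k 1 * v 3)], ?_, ?_⟩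
    swap
    · funext i
      fin_cases i <;> simp [Fv, hs]
    · generalize hw : ![s (v 2), s (sg k 1 * v 0), s (sg k 1 * v 1), s (v 4),
        s (sg k 1 * v 3)] = w
      have hFw : Fv σ w = sg k 1 • v := by
        rw [← hw]
        funext i
        fin_cases i <;> simp [Fv, hs]
      have h1 := hrel w
      rw [hFw, Matrix.mulVec_smul] at h1
      have h2 := congrArg (b'.mulVec) h1
      rw [Matrix.mulVec_mulVec, hbb, Matrix.mulVec_smul, Matrix.smul_mulVec,
        Matrix.one_mulVec] at h2
      intro i
      rw [← sigma_GeV σ q hq hσ]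
      have h3 := congrFun h2 i
      simp only [Pi.smul_apply, smul_eq_mul] at h3
      rw [← mul_left_cancel₀ (sg_ne_zero (k := k) 1) h3]
      simpa using GeV.mulVec hb' hv i
  obtain ⟨m, n, t, Y, h1, h2, h3, h4⟩ := core σ q hq hσ ((latt H).map Psi)
    (by
      rintro a _ ⟨v, hv, rfl⟩
      refine ⟨_, smul_mem_latt (GeV_C a) hv, ?_⟩
      rw [Psi_smul, tau_C, tau_C])
    (by
      rintro _ ⟨v, hv, rfl⟩
      exact ⟨_, hFm v hv, Psi_Fv σ q hq hσ v⟩)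
    (by
      rintro _ ⟨v, hv, rfl⟩
      obtain ⟨w, hw, hw2⟩ := hV v hv
      refine ⟨_, ⟨w, hw, rfl⟩, ?_⟩
      have := Psi_Fv σ q hq hσ w
      rw [hw2, Psi_smul, tau_sg, tau_sg, Prod.mk.injEq] at this
      exact ⟨this.1.symm, this.2.symm⟩)
    (by
      obtain ⟨N, hN⟩ := exists_GeV_matrix H'
      refine ⟨min (3 * N) (2 * N), ?_⟩
      rintro _ ⟨v, hv, rfl⟩
      have hvN : ∀ i, GeV N (v i) := by
        intro i
        have := GeV.mulVec hN hv i
        rw [Matrix.mulVec_mulVec, hH, Matrix.one_mulVec] at this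
        simpa using this
      exact ⟨(cb3_GeV (hvN _) (hvN _) (hvN _)).mono (min_le_left _ _),
        (cb2_GeV (hvN _) (hvN _)).mono (min_le_right _ _)⟩)
    (by
      obtain ⟨N, hN⟩ := exists_GeV_matrix H
      refine ⟨max (3 * (-N)) (2 * (-N)), fun x y hx hy => ?_⟩
      obtain ⟨v, hv, hvN⟩ := Psi_surj (-N) x y (hx.mono (le_max_left _ _))
        (hy.mono (le_max_right _ _))
      refine ⟨v, fun i => ?_, hv⟩
      simpa using GeV.mulVec hN hvN i)
  obtain ⟨E3, hE3, hP3⟩ := h1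
  obtain ⟨E5, hE5, hP5⟩ := (h3 (sg k n)).2 (GeV.sg n)
  have hσsg := sigma_sg σ q hq hσ
  have hPF := Psi_Fv σ q hq hσ
  refine ⟨t, E3, E5, hE3, hE5, hFm, ?_, ?_, ?_⟩
  · apply Psi_inj
    simp only [map_add, Psi_smul, hPF, hP3, hP5, h4, tau_sg, tau_C, Prod.mk_add_mk,
      Prod.mk.injEq, hσsg, sg_mul_sg, map_zero, mul_zero, add_zero, mul_one, and_true]
    congr 1
    ring
  · apply Psi_inj
    simp only [Psi_smul, hPF, hP5, tau_sg, Prod.mk.injEq, hσsg, sg_mul_sg, map_zero, mul_zero,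
      mul_one, true_and]
    congr 1
    ring
  · intro v hv
    have hX := h2 _ ⟨v, hv, rfl⟩
    obtain ⟨a0, a1, a2, ha, haN⟩ := exists_cb3 (sg k (-m) * (Psi v).1)
    obtain ⟨ha0, ha1, ha2⟩ := haN 0 ((hX.sg_mul (-m)).mono (by omega))
    have hXe : (Psi v).1 = sg k m * cb3 a0 a1 a2 := by
      rw [ha, ← mul_assoc, sg_mul_sg, add_neg_cancel, sg_zero, one_mul]
    obtain ⟨v', hv'⟩ : ∃ v', v' = v - (a2 • Fv σ (Fv σ E3) + a1 • Fv σ E3 + a0 • E3) := ⟨_, rfl⟩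
    have hmem : v' ∈ latt H := by
      rw [hv']
      exact (latt H).sub_mem hv ((latt H).add_mem ((latt H).add_mem
        (smul_mem_latt ha2 (hFm _ (hFm _ hE3))) (smul_mem_latt ha1 (hFm _ hE3)))
        (smul_mem_latt ha0 hE3))
    have hz : (Psi v').1 = 0 := by
      rw [hv']
      simp only [map_sub, map_add, Psi_smul, hPF, hP3, Prod.fst_sub, Prod.fst_add, hXe, cb3, map_mul, hσsg]
      have : sg k 2 = sg k 1 * sg k 1 := by rw [sg_mul_sg]; rfl
      rw [this]
      ring
    have hY : GeV n (Psi v').2 := by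
      rw [← h3, ← hz]
      exact ⟨v', hmem, rfl⟩
    obtain ⟨c0, c1, hc, hcN⟩ := exists_cb2 (sg k (-n) * (Psi v').2)
    obtain ⟨hc0, hc1⟩ := hcN 0 ((hY.sg_mul (-n)).mono (by omega))
    have hYe : (Psi v').2 = sg k n * cb2 c0 c1 := by
      rw [hc, ← mul_assoc, sg_mul_sg, add_neg_cancel, sg_zero, one_mul]
    have hfin : v' = c1 • Fv σ E5 + c0 • E5 := by
      apply Psi_inj
      refine Prod.ext ?_ ?_
      · rw [hz]
        simp [Psi_smul, hPF, hP5]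
      · rw [hYe]
        simp only [map_add, Psi_smul, hPF, hP5, Prod.snd_add, hσsg, cb2]
        ring
    refine ⟨![a2, a1, a0, c1, c0], ?_, ?_⟩
    · intro i
      fin_cases i <;> assumption
    · have : v = v' + (a2 • Fv σ (Fv σ E3) + a1 • Fv σ E3 + a0 • E3) := by
        rw [hv', sub_add_cancel]
      rw [this, hfin]
      simp only [Matrix.cons_val]
      abel

end Assembly

/-- The representative lemma of Section 3.3: every `b ∈ Kε^μK`, `μ = (1,1,0,0,0)`,
that is `σ`-conjugate to `b₂` (slopes `(1/3,1/3,1/3,1/2,1/2)`) can be brought into the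
form `x_t` by `K`-`σ`-conjugation. -/
theorem statement10 (p r q : ℕ) [Fact p.Prime] (hr : 0 < r) (hq : q = p ^ r)
    (k : Type*) [Field k] [Algebra (GaloisField p r) k] [IsAlgClosure (GaloisField p r) k]
    (σL : LaurentSeries k →+* LaurentSeries k)
    (hσL : ∀ (x : LaurentSeries k) (m : ℤ), (σL x).coeff m = x.coeff m ^ q)
    (b : GL (Fin 5) (LaurentSeries k))
    -- `b ∈ K·ε^μ·K` with `ε^μ = diag(ε,ε,1,1,1)`
    (hbμ : ∃ u w : GL (Fin 5) (LaurentSeries k), InK u ∧ InK w ∧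
      (b : Matrix (Fin 5) (Fin 5) (LaurentSeries k)) =
        (u : Matrix (Fin 5) (Fin 5) (LaurentSeries k)) *
        Matrix.diagonal ![HahnSeries.single (1 : ℤ) 1, HahnSeries.single (1 : ℤ) 1, 1, 1, 1] *
        (w : Matrix (Fin 5) (Fin 5) (LaurentSeries k)))
    -- `b` is `σ`-conjugate in `GL₅(L)` to `b₂`
    (hbσ : ∃ h : GL (Fin 5) (LaurentSeries k),
      ((h⁻¹ : GL (Fin 5) (LaurentSeries k)) : Matrix (Fin 5) (Fin 5) (LaurentSeries k)) *
        (b : Matrix (Fin 5) (Fin 5) (LaurentSeries k)) *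
        (RingHom.mapMatrix σL) (h : Matrix (Fin 5) (Fin 5) (LaurentSeries k)) =
      (!![0, 1, 0, 0, 0;
          0, 0, 1, 0, 0;
          HahnSeries.single (1 : ℤ) 1, 0, 0, 0, 0;
          0, 0, 0, 0, 1;
          0, 0, 0, HahnSeries.single (1 : ℤ) 1, 0] :
        Matrix (Fin 5) (Fin 5) (LaurentSeries k))) :
    ∃ t : k, ∃ g : GL (Fin 5) (LaurentSeries k), InK g ∧
      ((g⁻¹ : GL (Fin 5) (LaurentSeries k)) : Matrix (Fin 5) (Fin 5) (LaurentSeries k)) *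
        (b : Matrix (Fin 5) (Fin 5) (LaurentSeries k)) *
        (RingHom.mapMatrix σL) (g : Matrix (Fin 5) (Fin 5) (LaurentSeries k)) =
      (!![0, 1, 0, 0, 0;
          0, 0, 1, 0, 0;
          HahnSeries.single (1 : ℤ) 1, 0, 0, 0, 0;
          HahnSeries.C t, 0, 0, 0, 1;
          0, 0, 0, HahnSeries.single (1 : ℤ) 1, 0] :
        Matrix (Fin 5) (Fin 5) (LaurentSeries k)) := by
  have hq0 : 0 < q := by
    rw [hq]
    exact pow_pos (Fact.out : p.Prime).pos r
  have : IsAlgClosed k := IsAlgClosure.isAlgClosed (GaloisField p r)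
  obtain ⟨u, w, hu, hw, hbe⟩ := hbμ
  obtain ⟨h, hh⟩ := hbσ
  have hD : ∀ i j, GeV 0 ((Matrix.diagonal ![HahnSeries.single (1 : ℤ) 1,
      HahnSeries.single (1 : ℤ) 1, 1, 1, 1] : Matrix (Fin 5) (Fin 5) (LaurentSeries k)) i j) := by
    have h1 : GeV 0 (HahnSeries.single (1 : ℤ) 1 : LaurentSeries k) := (GeV.sg 1).mono (by norm_num)
    have h2 : GeV 0 (1 : LaurentSeries k) := GeV.sg 0
    intro i j
    rw [Matrix.diagonal_apply]
    split_ifs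
    · fin_cases i <;> assumption
    · exact GeV.zero 0
  have hD' : ∀ i j, GeV 0 ((Matrix.diagonal ![1, 1, sg k 1, sg k 1, sg k 1] :
      Matrix (Fin 5) (Fin 5) (LaurentSeries k)) i j) := by
    have h1 : GeV 0 (sg k 1) := (GeV.sg 1).mono (by norm_num)
    have h2 : GeV 0 (1 : LaurentSeries k) := GeV.sg 0
    intro i j
    rw [Matrix.diagonal_apply]
    split_ifs
    · fin_cases i <;> assumption
    · exact GeV.zero 0
  have hDD : (Matrix.diagonal ![1, 1, sg k 1, sg k 1, sg k 1] :
      Matrix (Fin 5) (Fin 5) (LaurentSeries k)) * Matrix.diagonal ![HahnSeries.single (1 : ℤ) 1,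
      HahnSeries.single (1 : ℤ) 1, 1, 1, 1] = sg k 1 • 1 := by
    rw [Matrix.diagonal_mul_diagonal, ← Matrix.diagonal_one, ← Matrix.diagonal_smul]
    congr 1
    funext i
    fin_cases i <;> simp [sg]
  have hbO : ∀ i j, GeV 0 ((b : Matrix (Fin 5) (Fin 5) (LaurentSeries k)) i j) := by
    rw [hbe]
    exact GeV.matmul (GeV.matmul hu.1 hD) hw.1
  have hhinv : ((h⁻¹ : GL (Fin 5) (LaurentSeries k)) : Matrix (Fin 5) (Fin 5) (LaurentSeries k)) *
      (h : Matrix (Fin 5) (Fin 5) (LaurentSeries k)) = 1 := h.inv_mul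
  have hhinv' : (h : Matrix (Fin 5) (Fin 5) (LaurentSeries k)) *
      ((h⁻¹ : GL (Fin 5) (LaurentSeries k)) : Matrix (Fin 5) (Fin 5) (LaurentSeries k)) = 1 :=
    h.mul_inv
  obtain ⟨t, E3, E5, hE3, hE5, hFm, r1, r2, hspan⟩ := exists_basis σL q hq0 hσL
    (b : Matrix (Fin 5) (Fin 5) (LaurentSeries k))
    (((w⁻¹ : GL (Fin 5) (LaurentSeries k)) : Matrix (Fin 5) (Fin 5) (LaurentSeries k)) *
      Matrix.diagonal ![1, 1, sg k 1, sg k 1, sg k 1] *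
      ((u⁻¹ : GL (Fin 5) (LaurentSeries k)) : Matrix (Fin 5) (Fin 5) (LaurentSeries k)))
    (h : Matrix (Fin 5) (Fin 5) (LaurentSeries k))
    ((h⁻¹ : GL (Fin 5) (LaurentSeries k)) : Matrix (Fin 5) (Fin 5) (LaurentSeries k))
    hbO (GeV.matmul (GeV.matmul hw.2 hD') hu.2)
    (by
      have e1 : ((u⁻¹ : GL (Fin 5) (LaurentSeries k)) : Matrix (Fin 5) (Fin 5) (LaurentSeries k)) *
        (u : Matrix (Fin 5) (Fin 5) (LaurentSeries k)) = 1 := u.inv_mul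
      have e2 : ((w⁻¹ : GL (Fin 5) (LaurentSeries k)) : Matrix (Fin 5) (Fin 5) (LaurentSeries k)) *
        (w : Matrix (Fin 5) (Fin 5) (LaurentSeries k)) = 1 := w.inv_mul
      rw [hbe, Matrix.mul_assoc, Matrix.mul_assoc (u : Matrix (Fin 5) (Fin 5) (LaurentSeries k)),
        ← Matrix.mul_assoc _ (u : Matrix (Fin 5) (Fin 5) (LaurentSeries k)), e1, Matrix.one_mul,
        Matrix.mul_assoc, ← Matrix.mul_assoc (Matrix.diagonal _) (Matrix.diagonal _), hDD,
        Matrix.smul_mul, Matrix.one_mul, Matrix.mul_smul, e2])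
    hhinv
    (by
      intro v
      rw [← Fv_eq, ← hh, Matrix.mulVec_mulVec, Matrix.mul_assoc, ← Matrix.mul_assoc, hhinv',
        Matrix.one_mul, ← Matrix.mulVec_mulVec]
      congr 1
      funext i
      exact (RingHom.map_mulVec σL _ v i).symm)
  -- the matrix of the new basis
  obtain ⟨P, hPdef⟩ : ∃ P : Matrix (Fin 5) (Fin 5) (LaurentSeries k), ∀ i j, P i j =
    (![Fv σL (Fv σL E3), Fv σL E3, E3, Fv σL E5, E5] : Fin 5 → Fin 5 → LaurentSeries k) j i :=
    ⟨fun i j => _, fun i j => rfl⟩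
  have hmem : ∀ j, (fun i => P i j) ∈ latt (h : Matrix (Fin 5) (Fin 5) (LaurentSeries k)) := by
    intro j
    simp only [hPdef]
    fin_cases j
    · exact hFm _ (hFm _ hE3)
    · exact hFm _ hE3
    · exact hE3
    · exact hFm _ hE5
    · exact hE5
  have hPx : (!![0, 1, 0, 0, 0;
          0, 0, 1, 0, 0;
          HahnSeries.single (1 : ℤ) 1, 0, 0, 0, 0;
          0, 0, 0, 0, 1;
          0, 0, 0, HahnSeries.single (1 : ℤ) 1, 0] :
        Matrix (Fin 5) (Fin 5) (LaurentSeries k)) * σL.mapMatrix P = P *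
      (!![0, 1, 0, 0, 0;
          0, 0, 1, 0, 0;
          HahnSeries.single (1 : ℤ) 1, 0, 0, 0, 0;
          HahnSeries.C t, 0, 0, 0, 1;
          0, 0, 0, HahnSeries.single (1 : ℤ) 1, 0] :
        Matrix (Fin 5) (Fin 5) (LaurentSeries k)) := by
    ext1 i j
    have hl := congrFun (Fv_eq σL (fun i => P i j)) i
    refine Eq.trans hl ?_
    rw [Matrix.mul_apply, Fin.sum_univ_five]
    simp only [hPdef]
    fin_cases j
    · refine (congrFun r1 i).trans ?_
      simp [sg, mul_comm]
    · simp
    · simp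
    · refine (congrFun r2 i).trans ?_
      simp [sg, mul_comm]
    · simp
  have hC : ∀ j, ∃ c : Fin 5 → LaurentSeries k, (∀ i, GeV 0 (c i)) ∧
      P.mulVec c = fun i => ((h⁻¹ : GL (Fin 5) (LaurentSeries k)) :
        Matrix (Fin 5) (Fin 5) (LaurentSeries k)) i j := by
    intro j
    obtain ⟨c, hc, hce⟩ := hspan (fun i => ((h⁻¹ : GL (Fin 5) (LaurentSeries k)) :
        Matrix (Fin 5) (Fin 5) (LaurentSeries k)) i j) (by
      intro i
      have e := congrFun (congrFun hhinv' i) j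
      rw [Matrix.mul_apply] at e
      rw [Matrix.mulVec, dotProduct, e, Matrix.one_apply]
      split_ifs
      · exact GeV.sg 0
      · exact GeV.zero 0)
    refine ⟨c, hc, ?_⟩
    rw [hce]
    funext i
    simp [Matrix.mulVec, dotProduct, Fin.sum_univ_five, hPdef, mul_comm]
  choose c hc hce using hC
  have hPC : P * Matrix.of (fun i j => c j i) =
      ((h⁻¹ : GL (Fin 5) (LaurentSeries k)) : Matrix (Fin 5) (Fin 5) (LaurentSeries k)) := by
    ext1 i j
    exact congrFun (hce j) i
  have hone : ((h : Matrix (Fin 5) (Fin 5) (LaurentSeries k)) * P) *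
      Matrix.of (fun i j => c j i) = 1 := by
    rw [Matrix.mul_assoc, hPC, hhinv']
  have hone' := mul_eq_one_comm.1 hone
  refine ⟨t, ⟨_, _, hone, hone'⟩, ⟨fun i j => hmem j i, fun i j => hc j i⟩, ?_⟩
  change Matrix.of (fun i j => c j i) * (b : Matrix (Fin 5) (Fin 5) (LaurentSeries k)) *
    σL.mapMatrix ((h : Matrix (Fin 5) (Fin 5) (LaurentSeries k)) * P) = _
  have hbh : (b : Matrix (Fin 5) (Fin 5) (LaurentSeries k)) *
      σL.mapMatrix (h : Matrix (Fin 5) (Fin 5) (LaurentSeries k)) =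
      (h : Matrix (Fin 5) (Fin 5) (LaurentSeries k)) *
      (!![0, 1, 0, 0, 0;
          0, 0, 1, 0, 0;
          HahnSeries.single (1 : ℤ) 1, 0, 0, 0, 0;
          0, 0, 0, 0, 1;
          0, 0, 0, HahnSeries.single (1 : ℤ) 1, 0] :
        Matrix (Fin 5) (Fin 5) (LaurentSeries k)) := by
    rw [← hh, Matrix.mul_assoc, ← Matrix.mul_assoc, hhinv', Matrix.one_mul]
  rw [map_mul, Matrix.mul_assoc, ← Matrix.mul_assoc (b : Matrix (Fin 5) (Fin 5) (LaurentSeries k)),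
    hbh, Matrix.mul_assoc (h : Matrix (Fin 5) (Fin 5) (LaurentSeries k)), hPx, ← Matrix.mul_assoc,
    ← Matrix.mul_assoc, Matrix.mul_assoc (Matrix.of _), hone', Matrix.one_mul]
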